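/- Let G be a set of real-valued functions on X, ν : G → ℝ with 0 ≤ ν(g) ≤ G₀ for every g ∈ G for some constant G₀ > 0, and assume G is closed under dual post-processing: for every g ∈ G and every 1-Lipschitz h : ℝ → [−4,4], the function x ↦ g(x) + h(g(x)) belongs to G. Let λ ≥ 0, let S = ((x₁,y₁),…,(xₙ,yₙ)) be a sample with labels yᵢ ∈ {0,1}, define L_n(g) := (1/n)Σᵢ ℓ^ψ(g(xᵢ),yᵢ) + λ·ν(g)², let g*_n ∈ G be a minimizer of L_n over G, and set err_n(g) := L_n(g) − L_n(g*_n). Then for every g ∈ G: pGap^{ψ,1/4}(g,S) ≤ λ·G₀² + err_n(g), and consequently smCE^{ψ,1/4}(g,S) ≤ √(λ·G₀² + err_n(g)/2). -/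

import Mathlib

open Set
open scoped NNReal

/-- The sigmoid function `σ(s) = 1/(1+e^{−s})`. -/
noncomputable def sigm (s : ℝ) : ℝ := 1 / (1 + Real.exp (-s))

/-- The logistic (dual) loss `ℓ^ψ(s,y) = log(1+eˢ) − s·y`. -/
noncomputable def logisticLoss (s y : ℝ) : ℝ := Real.log (1 + Real.exp s) - s * y

/-- Empirical dual smooth calibration error of a logit function `g` on a sample `S`. -/
noncomputable def smCEdualEmp {X : Type*} (n : ℕ) (S : Fin n → X × ℝ) (g : X → ℝ) : ℝ :=
  sSup {r : ℝ | ∃ h : ℝ → ℝ, LipschitzWith (1/4 : ℝ≥0) h ∧ (∀ v : ℝ, h v ∈ Icc (-1:ℝ) 1) ∧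
    r = (1 / n : ℝ) * ∑ i, h (g (S i).1) * ((S i).2 - sigm (g (S i).1))}

/-- Empirical dual post-processing gap of a logit function `g` on a sample `S`. -/
noncomputable def pGapdualEmp {X : Type*} (n : ℕ) (S : Fin n → X × ℝ) (g : X → ℝ) : ℝ :=
  (1 / n : ℝ) * ∑ i, logisticLoss (g (S i).1) (S i).2 -
    sInf {r : ℝ | ∃ h : ℝ → ℝ, LipschitzWith 1 h ∧ (∀ v : ℝ, h v ∈ Icc (-4:ℝ) 4) ∧
      r = (1 / n : ℝ) * ∑ i, logisticLoss (g (S i).1 + h (g (S i).1)) (S i).2}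

lemma sigm_eq_sigmoid : sigm = Real.sigmoid := by
  ext s
  simp [sigm, Real.sigmoid_def]

lemma hasDerivAt_log_one_add_exp (s : ℝ) :
    HasDerivAt (fun x => Real.log (1 + Real.exp x)) (sigm s) s := by
  have hpos : 0 < 1 + Real.exp s := by positivity
  convert ((Real.hasDerivAt_exp s).const_add 1).log hpos.ne' using 1
  rw [sigm, Real.exp_neg]
  have := Real.exp_pos s
  field_simp
  ring

/-- The sigmoid is `1/4`-Lipschitz, in the form that `x/4 - σ(x)` is monotone. -/
lemma monotone_div_four_sub_sigm : Monotone fun x => x / 4 - sigm x := by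
  have hderiv : ∀ x, HasDerivAt (fun x => x / 4 - sigm x)
      (1 / 4 - Real.sigmoid x * (1 - Real.sigmoid x)) x := fun x => by
    rw [sigm_eq_sigmoid]
    exact ((hasDerivAt_id x).div_const 4).sub (Real.hasDerivAt_sigmoid x)
  refine monotone_of_deriv_nonneg (fun x => (hderiv x).differentiableAt) fun x => ?_
  rw [(hderiv x).deriv]
  nlinarith [sq_nonneg (Real.sigmoid x - 1 / 2)]

/-- The logistic loss is `1/4`-smooth. -/
lemma logisticLoss_add_le (s t y : ℝ) :
    logisticLoss (s + t) y ≤ logisticLoss s y - t * (y - sigm s) + t ^ 2 / 8 := by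
  have hderiv : ∀ x, HasDerivAt (fun x => x ^ 2 / 8 - Real.log (1 + Real.exp x))
      (x / 4 - sigm x) x := fun x => by
    refine (((hasDerivAt_pow 2 x).div_const 8).sub (hasDerivAt_log_one_add_exp x)).congr_deriv ?_
    push_cast
    ring
  have hconv : ConvexOn ℝ univ fun x => x ^ 2 / 8 - Real.log (1 + Real.exp x) := by
    refine Monotone.convexOn_univ_of_deriv (fun x => (hderiv x).differentiableAt) ?_
    rw [funext fun x => (hderiv x).deriv]
    exact monotone_div_four_sub_sigm
  unfold logisticLoss
  rcases lt_trichotomy t 0 with ht | rfl | ht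
  · have h := hconv.slope_le_of_hasDerivAt (mem_univ (s + t)) (mem_univ s) (by linarith) (hderiv s)
    rw [slope_def_field, div_le_iff₀ (by linarith)] at h
    linarith
  · simp
  · have h := hconv.le_slope_of_hasDerivAt (mem_univ s) (mem_univ (s + t)) (by linarith) (hderiv s)
    rw [slope_def_field, le_div_iff₀ (by linarith)] at h
    linarith

lemma one_div_mul_sum_le_of_le {n : ℕ} (hn : 0 < n) {f : Fin n → ℝ} {c : ℝ} (hf : ∀ i, f i ≤ c) :
    (1 / n : ℝ) * ∑ i, f i ≤ c := by
  have hn' : (0 : ℝ) < n := by exact_mod_cast hn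
  have h := Finset.sum_le_card_nsmul Finset.univ f c fun i _ => hf i
  rw [Finset.card_univ, Fintype.card_fin, nsmul_eq_mul] at h
  rw [one_div_mul_eq_div, div_le_iff₀ hn']
  linarith

/-- A test function with correlation `r` yields a post-processing that improves the average
logistic loss by at least `2 * r ^ 2`. -/
lemma exists_postprocessing_loss_le {X : Type*} {n : ℕ} (hn : 0 < n) (S : Fin n → X × ℝ)
    (hy : ∀ i, (S i).2 ∈ Icc (0 : ℝ) 1) (g : X → ℝ) {h : ℝ → ℝ}
    (hlip : LipschitzWith (1 / 4 : ℝ≥0) h) (hbd : ∀ v, h v ∈ Icc (-1 : ℝ) 1) :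
    ∃ k : ℝ → ℝ, LipschitzWith 1 k ∧ (∀ v, k v ∈ Icc (-4 : ℝ) 4) ∧
      (1 / n : ℝ) * ∑ i, logisticLoss (g (S i).1 + k (g (S i).1)) (S i).2 ≤
        (1 / n : ℝ) * ∑ i, logisticLoss (g (S i).1) (S i).2 -
          2 * ((1 / n : ℝ) * ∑ i, h (g (S i).1) * ((S i).2 - sigm (g (S i).1))) ^ 2 := by
  set r := (1 / n : ℝ) * ∑ i, h (g (S i).1) * ((S i).2 - sigm (g (S i).1)) with hr
  have habs : ∀ v, |h v| ≤ 1 := fun v => abs_le.2 (hbd v)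
  have hterm : ∀ i, |h (g (S i).1) * ((S i).2 - sigm (g (S i).1))| ≤ 1 := fun i => by
    rw [abs_mul, sigm_eq_sigmoid]
    refine mul_le_one₀ (habs _) (abs_nonneg _) (abs_le.2 ?_)
    have h0 := Real.sigmoid_nonneg (g (S i).1)
    have h1 := Real.sigmoid_le_one (g (S i).1)
    obtain ⟨hy0, hy1⟩ := hy i
    constructor <;> linarith
  have hr1 : |r| ≤ 1 := by
    refine abs_le'.2 ⟨one_div_mul_sum_le_of_le hn fun i => (abs_le'.1 (hterm i)).1, ?_⟩
    rw [hr, ← mul_neg, ← Finset.sum_neg_distrib]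
    exact one_div_mul_sum_le_of_le hn fun i => (abs_le'.1 (hterm i)).2
  refine ⟨fun v => 4 * r * h v, ?_, fun v => abs_le.1 ?_, ?_⟩
  · refine LipschitzWith.of_dist_le_mul fun x y => ?_
    have hd := hlip.dist_le_mul x y
    rw [Real.dist_eq] at hd
    rw [Real.dist_eq, ← mul_sub, abs_mul, abs_mul, abs_of_pos (four_pos : (0 : ℝ) < 4)]
    push_cast at hd ⊢
    nlinarith [mul_le_mul_of_nonneg_right hr1 (abs_nonneg (h x - h y))]
  · rw [abs_mul, abs_mul, abs_of_pos (four_pos : (0 : ℝ) < 4)]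
    nlinarith [mul_le_one₀ hr1 (abs_nonneg _) (habs v)]
  · have hsum : (1 / n : ℝ) * ∑ i, (logisticLoss (g (S i).1 + 4 * r * h (g (S i).1)) (S i).2
        - logisticLoss (g (S i).1) (S i).2
        + 4 * r * (h (g (S i).1) * ((S i).2 - sigm (g (S i).1)))) ≤ 2 * r ^ 2 := by
      refine one_div_mul_sum_le_of_le hn fun i => ?_
      have hsm := logisticLoss_add_le (g (S i).1) (4 * r * h (g (S i).1)) (S i).2
      have hsq : h (g (S i).1) ^ 2 ≤ 1 := (sq_le_one_iff_abs_le_one _).2 (habs _)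
      nlinarith [mul_le_mul_of_nonneg_left hsq (sq_nonneg r)]
    rw [Finset.sum_add_distrib, Finset.sum_sub_distrib, ← Finset.mul_sum, mul_add, mul_sub,
      mul_left_comm _ (4 * r), ← hr] at hsum
    linarith

/-- under L₂-regularized logistic ERM over a class `G` closed under dual
post-processing, for every `g ∈ G` the empirical dual post-processing gap is at most
`λ·G₀² + err_n(g)`, and hence `smCE^{ψ,1/4}(g,S) ≤ √(λ·G₀² + err_n(g)/2)`. -/
theorem pGapdualEmp_le_and_smCEdualEmp_le
    {X : Type*} (G : Set (X → ℝ)) (ν : (X → ℝ) → ℝ)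
    (G₀ : ℝ) (hG₀ : 0 < G₀) (hν : ∀ g ∈ G, ν g ∈ Icc (0:ℝ) G₀)
    (hclosed : ∀ g ∈ G, ∀ h : ℝ → ℝ, LipschitzWith 1 h → (∀ v : ℝ, h v ∈ Icc (-4:ℝ) 4) →
      (fun x => g x + h (g x)) ∈ G)
    (lam : ℝ) (hlam : 0 ≤ lam)
    (n : ℕ) (hn : 0 < n) (S : Fin n → X × ℝ)
    (hy : ∀ i, (S i).2 = 0 ∨ (S i).2 = 1)
    (Ln : (X → ℝ) → ℝ)
    (hLn : ∀ g, Ln g = (1 / n : ℝ) * ∑ i, logisticLoss (g (S i).1) (S i).2 + lam * ν g ^ 2)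
    (gstar : X → ℝ) (hgstarG : gstar ∈ G) (hmin : ∀ g ∈ G, Ln gstar ≤ Ln g)
    (g : X → ℝ) (hgG : g ∈ G) :
    pGapdualEmp n S g ≤ lam * G₀ ^ 2 + (Ln g - Ln gstar) ∧
      smCEdualEmp n S g ≤ Real.sqrt (lam * G₀ ^ 2 + (Ln g - Ln gstar) / 2) := by
  have hgap : ∀ h : ℝ → ℝ, LipschitzWith 1 h → (∀ v : ℝ, h v ∈ Icc (-4:ℝ) 4) →
      (1 / n : ℝ) * ∑ i, logisticLoss (g (S i).1) (S i).2 -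
        (lam * G₀ ^ 2 + (Ln g - Ln gstar)) ≤
      (1 / n : ℝ) * ∑ i, logisticLoss (g (S i).1 + h (g (S i).1)) (S i).2 := by
    intro h hlip hbd
    have hmem := hclosed g hgG h hlip hbd
    have hle := hmin _ hmem
    rw [hLn fun x => g x + h (g x)] at hle
    have hreg := mul_le_mul_of_nonneg_left
      (pow_le_pow_left₀ (hν _ hmem).1 (hν _ hmem).2 2) hlam
    have hreg' := mul_nonneg hlam (sq_nonneg (ν g))
    linarith [hLn g]
  constructor
  · rw [pGapdualEmp, sub_le_comm]
    refine le_csInf ⟨_, 0, LipschitzWith.const' 0, fun v => by simp, rfl⟩ ?_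
    rintro r ⟨h, hlip, hbd, rfl⟩
    exact hgap h hlip hbd
  · refine Real.sSup_le ?_ (Real.sqrt_nonneg _)
    rintro r ⟨h, hlip, hbd, rfl⟩
    have hy' : ∀ i, (S i).2 ∈ Icc (0 : ℝ) 1 := fun i => by
      rcases hy i with hi | hi <;> simp [hi]
    obtain ⟨k, hklip, hkbd, hk⟩ := exists_postprocessing_loss_le hn S hy' g hlip hbd
    have hreg := mul_nonneg hlam (sq_nonneg G₀)
    exact Real.le_sqrt_of_sq_le (by linarith [hgap k hklip hkbd])
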